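/- arXiv:0812.1556 — 7 statements merged into one kernel-verified Lean document; each statement's English description precedes it below -/
import Mathlib

section
/- Let R be a ring, let s : A ⟶ B be a quasi-isomorphism of cochain complexes of R-modules, let P be a bounded-above cochain complex of projective R-modules, and let b : P ⟶ B be any morphism of cochain complexes. Then there exists a morphism of cochain complexes a : P ⟶ A such that the composite s ∘ a is chain homotopic to b. -/
open CategoryTheory Limits

universe u

/-- If `s : A ⟶ B` is a quasi-isomorphism of cochain complexes of `R`-modules, `P` is a
bounded-above cochain complex of projective `R`-modules and `b : P ⟶ B` is any chain map,
then there is a chain map `a : P ⟶ A` with `a ≫ s` chain homotopic to `b`. -/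
theorem statement0 {R : Type u} [Ring R]
    (A B P : CochainComplex (ModuleCat.{u} R) ℤ)
    (s : A ⟶ B) (hs : QuasiIso s)
    (hbd : ∃ n : ℤ, ∀ i : ℤ, n < i → Limits.IsZero (P.X i))
    (hproj : ∀ i : ℤ, Module.Projective R (P.X i))
    (b : P ⟶ B) :
    ∃ a : P ⟶ A, Nonempty (Homotopy (a ≫ s) b) := by
  obtain ⟨n, hn⟩ := hbd
  have : P.IsStrictlyLE n := (CochainComplex.isStrictlyLE_iff P n).2 hn
  have (i : ℤ) : Projective (P.X i) := (IsProjective.iff_projective (P.X i)).1 (hproj i)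
  have : P.IsKProjective := CochainComplex.isKProjective_of_projective P n
  letI : HasDerivedCategory (ModuleCat.{u} R) := HasDerivedCategory.standard _
  let q := HomotopyCategory.quotient (ModuleCat.{u} R) (ComplexShape.up ℤ)
  have hiso : IsIso (DerivedCategory.Qh.map (q.map s)) :=
    (inferInstance : IsIso (DerivedCategory.Q.map s))
  obtain ⟨f, hf⟩ := (CochainComplex.IsKProjective.Qh_map_bijective P (q.obj A)).2
    (DerivedCategory.Qh.map (q.map b) ≫ inv (DerivedCategory.Qh.map (q.map s)))
  obtain ⟨a, rfl⟩ := q.map_surjective f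
  refine ⟨a, ⟨HomotopyCategory.homotopyOfEq _ _ ?_⟩⟩
  apply (CochainComplex.IsKProjective.Qh_map_bijective P (q.obj B)).1
  change DerivedCategory.Qh.map (q.map (a ≫ s)) = DerivedCategory.Qh.map (q.map b)
  rw [Functor.map_comp, Functor.map_comp, hf, Category.assoc, IsIso.inv_hom_id, Category.comp_id]
end

section
/- Let R be a ring, let s : A ⟶ B be a quasi-isomorphism of cochain complexes of R-modules, and let P be a bounded-above cochain complex of projective R-modules. If a, a' : P ⟶ A are morphisms of cochain complexes such that s ∘ a is chain homotopic to s ∘ a', then a is chain homotopic to a'. In particular, a lift of a given morphism b : P ⟶ B through s is unique up to chain homotopy. -/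
open CategoryTheory Limits

universe u

/-- If `s : A ⟶ B` is a quasi-isomorphism of cochain complexes of `R`-modules, `P` is a
bounded-above cochain complex of projective `R`-modules and `a, a' : P ⟶ A` are chain maps
such that `a ≫ s` and `a' ≫ s` are chain homotopic, then `a` and `a'` are chain homotopic.
In particular a lift of a morphism `b : P ⟶ B` through `s` is unique up to chain homotopy. -/
theorem statement1 {R : Type u} [Ring R]
    (A B P : CochainComplex (ModuleCat.{u} R) ℤ)
    (s : A ⟶ B) (hs : QuasiIso s)
    (hbd : ∃ n : ℤ, ∀ i : ℤ, n < i → Limits.IsZero (P.X i))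
    (hproj : ∀ i : ℤ, Module.Projective R (P.X i))
    (a a' : P ⟶ A)
    (h : Nonempty (Homotopy (a ≫ s) (a' ≫ s))) :
    Nonempty (Homotopy a a') := by
  obtain ⟨n, hn⟩ := hbd
  obtain ⟨h⟩ := h
  let := HasDerivedCategory.standard (ModuleCat.{u} R)
  have : P.IsStrictlyLE n := by
    rw [CochainComplex.isStrictlyLE_iff]
    exact hn
  have : ∀ i : ℤ, Projective (P.X i) := fun i ↦ by
    have := hproj i
    infer_instance
  have : P.IsKProjective := CochainComplex.isKProjective_of_projective P n
  refine ⟨HomotopyCategory.homotopyOfEq _ _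
    ((CochainComplex.IsKProjective.Qh_map_bijective P _).injective ?_)⟩
  have h1 := congrArg DerivedCategory.Qh.map (HomotopyCategory.eq_of_homotopy _ _ h)
  have h2 : IsIso (DerivedCategory.Qh.map ((HomotopyCategory.quotient _ _).map s)) :=
    (NatIso.isIso_map_iff (DerivedCategory.quotientCompQhIso (ModuleCat.{u} R)) s).2
      inferInstance
  rw [Functor.map_comp, Functor.map_comp, Functor.map_comp, Functor.map_comp] at h1
  exact (cancel_mono _).1 h1
end

section
/- Let R be a ring and let 0 → A → B → C → 0 be a short exact sequence of perfect cochain complexes of R-modules (exact in each degree). Then there exist a short exact sequence 0 → A' → B' → C' → 0 of bounded cochain complexes of finitely generated projective R-modules and quasi-isomorphisms a : A' → A, b : B' → B, c : C' → C making the resulting diagram of complexes commute. -/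
open CategoryTheory Limits

universe u

variable (R : Type u) [Ring R]

/-- A cochain complex is bounded if its components vanish outside finitely many degrees. -/
def IsBounded (P : CochainComplex (ModuleCat.{u} R) ℤ) : Prop :=
  ∃ a b : ℤ, ∀ i : ℤ, (i < a ∨ b < i) → Limits.IsZero (P.X i)

/-- A bounded cochain complex of finitely generated projective modules. -/
def IsBoundedFGProj (P : CochainComplex (ModuleCat.{u} R) ℤ) : Prop :=
  IsBounded R P ∧ (∀ i : ℤ, Module.Finite R (P.X i)) ∧ (∀ i : ℤ, Module.Projective R (P.X i))

/-- A cochain complex is perfect if it receives a quasi-isomorphism from a bounded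
complex of finitely generated projective modules. -/
def IsPerfect (A : CochainComplex (ModuleCat.{u} R) ℤ) : Prop :=
  ∃ (P : CochainComplex (ModuleCat.{u} R) ℤ) (f : P ⟶ A), IsBoundedFGProj R P ∧ QuasiIso f

/-- A pair of composable chain maps is a short exact sequence of complexes if it is
a short exact sequence of modules in each degree. -/
def IsShortExactSeq {A B C : CochainComplex (ModuleCat.{u} R) ℤ} (f : A ⟶ B) (g : B ⟶ C) : Prop :=
  ∀ i : ℤ, Function.Injective (f.f i) ∧ Function.Exact (f.f i) (g.f i) ∧
    Function.Surjective (g.f i)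


section Helpers

open CochainComplex HomComplex

variable {D : Type*} [Category D] [Abelian D]

lemma exists_lift_of_kprojective {P L B : CochainComplex D ℤ} [P.IsKProjective]
    (p : L ⟶ B) [QuasiIso p] (w : P ⟶ B) :
    ∃ v : P ⟶ L, Nonempty (Homotopy w (v ≫ p)) := by
  letI := HasDerivedCategory.standard D
  obtain ⟨g, hg⟩ := (IsKProjective.Qh_map_bijective P
    ((HomotopyCategory.quotient _ _).obj L)).surjective
    ((DerivedCategory.quotientCompQhIso D).hom.app P ≫ DerivedCategory.Q.map w ≫
      inv (DerivedCategory.Q.map p) ≫ (DerivedCategory.quotientCompQhIso D).inv.app L)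
  obtain ⟨v, rfl⟩ := (HomotopyCategory.quotient _ _).map_surjective g
  refine ⟨v, ⟨HomotopyCategory.homotopyOfEq _ _ ?_⟩⟩
  apply (IsKProjective.Qh_map_bijective _ _).injective
  rw [Functor.map_comp, Functor.map_comp, hg]
  have h1 := (DerivedCategory.quotientCompQhIso D).inv.naturality p
  have h2 := (DerivedCategory.quotientCompQhIso D).hom.naturality w
  dsimp at h1 h2
  simp only [Category.assoc]
  rw [← h1, IsIso.inv_hom_id_assoc, ← reassoc_of% h2]
  simp

noncomputable def coneIdBiprodEquiv (K L : CochainComplex D ℤ) :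
    HomotopyEquiv (mappingCone (𝟙 K) ⊞ L) L where
  hom := biprod.snd
  inv := biprod.inr
  homotopyHomInvId :=
    let h₀ : Homotopy (𝟙 (mappingCone (𝟙 K))) 0 :=
      mappingCone.liftHomotopy _ _ _ (mappingCone.snd _) 0 (by simp) (by simp)
    let h₁ := (h₀.compRight
      (biprod.inl : _ ⟶ mappingCone (𝟙 K) ⊞ L)).compLeft
        (biprod.fst : mappingCone (𝟙 K) ⊞ L ⟶ _)
    let h₂ := Homotopy.add h₁ (Homotopy.refl (biprod.snd ≫ biprod.inr))
    (Homotopy.ofEq (by simp)).trans (h₂.symm.trans (Homotopy.ofEq (by simp)))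
  homotopyInvHomId := Homotopy.ofEq (by simp)

/-- Resolution of a short exact sequence, with middle term an explicit cylinder-like complex. -/
lemma exists_resolution {S : ShortComplex (CochainComplex D ℤ)} (hS : S.ShortExact)
    {P Q : CochainComplex D ℤ} [P.IsKProjective] (p : P ⟶ S.X₁) (q : Q ⟶ S.X₂)
    [QuasiIso p] [QuasiIso q] :
    ∃ (T : CochainComplex D ℤ) (f' : P ⟶ mappingCone (𝟙 P) ⊞ Q)
      (g' : mappingCone (𝟙 P) ⊞ Q ⟶ T) (w : f' ≫ g' = 0)
      (b : mappingCone (𝟙 P) ⊞ Q ⟶ S.X₂) (c : T ⟶ S.X₃),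
      (ShortComplex.mk f' g' w).ShortExact ∧
      (∀ i, Nonempty (((ShortComplex.mk f' g' w).map (HomologicalComplex.eval _ _ i)).Splitting)) ∧
      QuasiIso b ∧ QuasiIso c ∧ f' ≫ b = p ≫ S.f ∧ g' ≫ c = b ≫ S.g := by
  obtain ⟨v, ⟨h⟩⟩ := exists_lift_of_kprojective q (p ≫ S.f)
  let b : mappingCone (𝟙 P) ⊞ Q ⟶ S.X₂ :=
    biprod.desc (mappingCone.desc (𝟙 P) (Cochain.ofHomotopy h) (p ≫ S.f - v ≫ q) (by simp)) q
  let f' : P ⟶ mappingCone (𝟙 P) ⊞ Q := biprod.lift (mappingCone.inr _) v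
  have hfb : f' ≫ b = p ≫ S.f := by simp [f', b]
  have hret (i : ℤ) : f'.f i ≫ (biprod.fst : mappingCone (𝟙 P) ⊞ Q ⟶ _).f i ≫
      (mappingCone.snd (𝟙 P)).v i i (add_zero i) = 𝟙 _ := by
    rw [← HomologicalComplex.comp_f_assoc]
    simp [f']
  have hm (i : ℤ) : Mono (f'.f i) := by
    have : IsSplitMono (f'.f i) := ⟨⟨⟨_, hret i⟩⟩⟩
    infer_instance
  have : Mono f' := HomologicalComplex.mono_of_mono_f f' hm
  have hw : f' ≫ b ≫ S.g = 0 := by rw [reassoc_of% hfb, S.zero, comp_zero]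
  let S' : ShortComplex (CochainComplex D ℤ) := ShortComplex.mk f' (cokernel.π f') (by simp)
  have hS' : S'.ShortExact :=
    { exact := ShortComplex.exact_cokernel f'
      mono_f := this
      epi_g := by dsimp [S']; infer_instance }
  have hb : QuasiIso b := by
    have h1 : QuasiIso (biprod.inr : Q ⟶ mappingCone (𝟙 P) ⊞ Q) :=
      (coneIdBiprodEquiv P Q).quasiIso_inv
    have h2 : (biprod.inr : Q ⟶ mappingCone (𝟙 P) ⊞ Q) ≫ b = q := by simp [b]
    have h3 : QuasiIso ((biprod.inr : Q ⟶ mappingCone (𝟙 P) ⊞ Q) ≫ b) := by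
      rw [h2]; infer_instance
    exact quasiIso_of_comp_left biprod.inr b
  let φ : S' ⟶ S :=
    { τ₁ := p
      τ₂ := b
      τ₃ := cokernel.desc f' (b ≫ S.g) hw
      comm₁₂ := hfb.symm
      comm₂₃ := by simp [S'] }
  refine ⟨_, f', cokernel.π f', by simp, b, cokernel.desc f' (b ≫ S.g) hw, hS', ?_, hb,
    HomologicalComplex.HomologySequence.quasiIso_τ₃ φ hS' hS inferInstance hb, hfb, by simp⟩
  intro i
  have hi := hS'.map_of_exact (HomologicalComplex.eval _ _ i)
  exact ⟨ShortComplex.Splitting.ofExactOfRetraction _ hi.exact _ (hret i) hi.epi_g⟩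

end Helpers

lemma fgproj_biprod {R : Type u} [Ring R] {X Y : ModuleCat.{u} R}
    (hX : Module.Finite R X ∧ Module.Projective R X)
    (hY : Module.Finite R Y ∧ Module.Projective R Y) :
    Module.Finite R ↑(X ⊞ Y) ∧ Module.Projective R ↑(X ⊞ Y) := by
  obtain ⟨_, _⟩ := hX
  obtain ⟨_, _⟩ := hY
  let e := (ModuleCat.biprodIsoProd X Y).toLinearEquiv.symm
  exact ⟨Module.Finite.equiv (M := X × Y) e, Module.Projective.of_equiv (M := X × Y) e⟩

lemma fgproj_retract {R : Type u} [Ring R] {X Y : ModuleCat.{u} R}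
    (hX : Module.Finite R X ∧ Module.Projective R X) (s : Y ⟶ X) (r : X ⟶ Y)
    (h : s ≫ r = 𝟙 Y) :
    Module.Finite R Y ∧ Module.Projective R Y := by
  obtain ⟨_, _⟩ := hX
  have h' : r.hom ∘ₗ s.hom = LinearMap.id := by rw [← ModuleCat.hom_comp, h]; rfl
  refine ⟨Module.Finite.of_surjective r.hom (fun y => ⟨s.hom y, LinearMap.congr_fun h' y⟩),
    Module.Projective.of_split s.hom r.hom h'⟩

theorem statement2 {R : Type u} [Ring R]
    (A B C : CochainComplex (ModuleCat.{u} R) ℤ)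
    (f : A ⟶ B) (g : B ⟶ C) (hses : IsShortExactSeq R f g)
    (hA : IsPerfect R A) (hB : IsPerfect R B) (hC : IsPerfect R C) :
    ∃ (A' B' C' : CochainComplex (ModuleCat.{u} R) ℤ)
      (f' : A' ⟶ B') (g' : B' ⟶ C') (a : A' ⟶ A) (b : B' ⟶ B) (c : C' ⟶ C),
      IsBoundedFGProj R A' ∧ IsBoundedFGProj R B' ∧ IsBoundedFGProj R C' ∧
      IsShortExactSeq R f' g' ∧
      QuasiIso a ∧ QuasiIso b ∧ QuasiIso c ∧
      f' ≫ b = a ≫ f ∧ g' ≫ c = b ≫ g := by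
  obtain ⟨P, p, hP, hp⟩ := hA
  obtain ⟨Q, q, hQ, hq⟩ := hB
  have w : f ≫ g = 0 := by
    ext i x
    exact (hses i).2.1.apply_apply_eq_zero x
  have hS : (ShortComplex.mk f g w).ShortExact := by
    apply HomologicalComplex.shortExact_of_degreewise_shortExact
    intro i
    obtain ⟨h1, h2, h3⟩ := hses i
    exact
      { exact := (ShortComplex.ShortExact.moduleCat_exact_iff_function_exact _).2 h2
        mono_f := (ModuleCat.mono_iff_injective _).2 h1
        epi_g := (ModuleCat.epi_iff_surjective _).2 h3 }
  have hKP : P.IsKProjective := by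
    obtain ⟨⟨a, b, hab⟩, _, hproj⟩ := hP
    have : P.IsStrictlyLE b := (P.isStrictlyLE_iff b).2 (fun i hi => hab i (Or.inr hi))
    have (n : ℤ) : Projective (P.X n) :=
      (IsProjective.iff_projective (P.X n)).1 (hproj n)
    exact CochainComplex.isKProjective_of_projective P b
  obtain ⟨T, f', g', w', b, c, hS', hsp, hb, hc, e1, e2⟩ := exists_resolution hS p q
  have hBX (i : ℤ) : (CochainComplex.mappingCone (𝟙 P) ⊞ Q).X i ≅
      (P.X (i + 1) ⊞ P.X i) ⊞ Q.X i :=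
    HomologicalComplex.biprodXIso _ _ i ≪≫
      biprod.mapIso (HomologicalComplex.homotopyCofiber.XIsoBiprod (𝟙 P) i (i + 1) rfl) (Iso.refl _)
  have hBf (i : ℤ) := fgproj_retract
    (fgproj_biprod (fgproj_biprod ⟨hP.2.1 (i + 1), hP.2.2 (i + 1)⟩ ⟨hP.2.1 i, hP.2.2 i⟩)
      ⟨hQ.2.1 i, hQ.2.2 i⟩) (hBX i).hom (hBX i).inv (hBX i).hom_inv_id
  have hBb : IsBounded R (CochainComplex.mappingCone (𝟙 P) ⊞ Q) := by
    obtain ⟨⟨a₁, b₁, h₁⟩, _⟩ := hP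
    obtain ⟨⟨a₂, b₂, h₂⟩, _⟩ := hQ
    refine ⟨min (a₁ - 1) a₂, max b₁ b₂, fun i hi => IsZero.of_iso ?_ (hBX i)⟩
    simp only [biprod_isZero_iff]
    exact ⟨⟨h₁ _ (by omega), h₁ _ (by omega)⟩, h₂ _ (by omega)⟩
  have hCf (i : ℤ) : Module.Finite R (T.X i) ∧ Module.Projective R (T.X i) := by
    obtain ⟨s⟩ := hsp i
    exact fgproj_retract (hBf i) s.s (g'.f i) s.s_g
  refine ⟨P, _, T, f', g', p, b, c, hP, ⟨hBb, fun i => (hBf i).1, fun i => (hBf i).2⟩,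
    ⟨?_, fun i => (hCf i).1, fun i => (hCf i).2⟩, ?_, hp, hb, hc, e1, e2⟩
  · obtain ⟨a₁, b₁, h⟩ := hBb
    refine ⟨a₁, b₁, fun i hi => ?_⟩
    obtain ⟨s⟩ := hsp i
    rw [IsZero.iff_id_eq_zero]
    have h1 : s.s ≫ g'.f i = 𝟙 (T.X i) := s.s_g
    rw [← h1, (h i hi).eq_of_src (g'.f i) 0]
    exact comp_zero
  · intro i
    have hi := hS'.map_of_exact (HomologicalComplex.eval _ _ i)
    exact ⟨(ModuleCat.mono_iff_injective _).1 hi.mono_f,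
      (ShortComplex.ShortExact.moduleCat_exact_iff_function_exact _).1 hi.exact,
      (ModuleCat.epi_iff_surjective _).1 hi.epi_g⟩
end

section
/- Let R be a regular ring, i.e. R is noetherian and every finitely generated R-module admits a finite resolution by finitely generated projective R-modules. Then every bounded cochain complex of finitely generated R-modules is perfect: it admits a quasi-isomorphism from a bounded cochain complex of finitely generated projective R-modules. -/
open CategoryTheory Limits

universe u

variable (R : Type u) [Ring R]

section PerfectHelpers

open CategoryTheory Limits

/-- finite projective dimension -/
def FinPD {R : Type u} [Ring R] (M : ModuleCat.{u} R) : Prop :=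
  ∃ n : ℕ, HasProjectiveDimensionLT M n

variable {R : Type u} [Ring R]

lemma FinPD.of_isZero {M : ModuleCat.{u} R} (h : IsZero M) : FinPD M :=
  ⟨0, h.hasProjectiveDimensionLT_zero⟩

lemma FinPD.of_projective (M : ModuleCat.{u} R) (h : Module.Projective R M) : FinPD M :=
  ⟨1, by
    have : Projective M := (IsProjective.iff_projective.{u} (R := R) M).1 h
    infer_instance⟩

lemma FinPD.of_iso {M N : ModuleCat.{u} R} (e : M ≅ N) (h : FinPD M) : FinPD N := by
  obtain ⟨n, hn⟩ := h
  exact ⟨n, hasProjectiveDimensionLT_of_iso e n⟩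

lemma FinPD.X₁ {S : ShortComplex (ModuleCat.{u} R)} (hS : S.ShortExact)
    (h₂ : FinPD S.X₂) (h₃ : FinPD S.X₃) : FinPD S.X₁ := by
  obtain ⟨n, hn⟩ := h₂
  obtain ⟨m, hm⟩ := h₃
  exact ⟨max n m, hS.hasProjectiveDimensionLT_X₁ _
    (hasProjectiveDimensionLT_of_ge _ n _ (by omega))
    (hasProjectiveDimensionLT_of_ge _ m _ (by omega))⟩

lemma FinPD.X₃ {S : ShortComplex (ModuleCat.{u} R)} (hS : S.ShortExact)
    (h₁ : FinPD S.X₁) (h₂ : FinPD S.X₂) : FinPD S.X₃ := by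
  obtain ⟨n, hn⟩ := h₁
  obtain ⟨m, hm⟩ := h₂
  exact ⟨max n m + 1, hS.hasProjectiveDimensionLT_X₃ _
    (hasProjectiveDimensionLT_of_ge _ n _ (by omega))
    (hasProjectiveDimensionLT_of_ge _ m _ (by omega))⟩

lemma FinPD.coker {K X Y Z : ModuleCat.{u} R}
    (f : K ⟶ X) (g : X ⟶ Y) (h : Y ⟶ Z) (w₁ : f ≫ g = 0) (w₂ : g ≫ h = 0)
    [Mono f] [Epi h] (e₁ : (ShortComplex.mk f g w₁).Exact) (e₂ : (ShortComplex.mk g h w₂).Exact)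
    (hK : FinPD K) (hX : FinPD X) (hY : FinPD Y) : FinPD Z := by
  have w₁' : f ≫ Abelian.factorThruImage g = 0 := by
    rw [← cancel_mono (Abelian.image.ι g)]; simpa using w₁
  have w₂' : Abelian.image.ι g ≫ h = 0 := by
    rw [← cancel_epi (Abelian.factorThruImage g)]; simpa using w₂
  have h1 : (ShortComplex.mk f (Abelian.factorThruImage g) w₁').ShortExact :=
    { exact := by
        let φ : ShortComplex.mk f (Abelian.factorThruImage g) w₁' ⟶ ShortComplex.mk f g w₁ :=
          { τ₁ := 𝟙 _, τ₂ := 𝟙 _, τ₃ := Abelian.image.ι g }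
        have : Epi φ.τ₁ := by dsimp [φ]; infer_instance
        have : IsIso φ.τ₂ := by dsimp [φ]; infer_instance
        have : Mono φ.τ₃ := by dsimp [φ]; infer_instance
        exact (ShortComplex.exact_iff_of_epi_of_isIso_of_mono φ).2 e₁
      mono_f := by dsimp; infer_instance
      epi_g := by dsimp; infer_instance }
  have h2 : (ShortComplex.mk (Abelian.image.ι g) h w₂').ShortExact :=
    { exact := by
        let φ : ShortComplex.mk g h w₂ ⟶ ShortComplex.mk (Abelian.image.ι g) h w₂' :=
          { τ₁ := Abelian.factorThruImage g, τ₂ := 𝟙 _, τ₃ := 𝟙 _ }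
        have : Epi φ.τ₁ := by dsimp [φ]; infer_instance
        have : IsIso φ.τ₂ := by dsimp [φ]; infer_instance
        have : Mono φ.τ₃ := by dsimp [φ]; infer_instance
        exact (ShortComplex.exact_iff_of_epi_of_isIso_of_mono φ).1 e₂
      mono_f := by dsimp; infer_instance
      epi_g := by dsimp; infer_instance }
  exact FinPD.X₃ h2 (FinPD.X₃ h1 hK hX) hY

lemma cycles_exact (P : CochainComplex (ModuleCat.{u} R) ℤ) (i j : ℤ) (hij : i + 1 = j) :
    (ShortComplex.mk (P.iCycles i) (P.toCycles i j)
      (by rw [← cancel_mono (P.iCycles j)]; simp)).Exact := by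
  apply ShortComplex.exact_of_f_is_kernel
  exact isKernelOfComp (P.iCycles j) _ (P.cyclesIsKernel i j (by simp [hij])) _
    (P.toCycles_i i j)

lemma cycles_shortExact (P : CochainComplex (ModuleCat.{u} R) ℤ) (i j : ℤ) (hij : i + 1 = j)
    (hj : P.ExactAt j) :
    (ShortComplex.mk (P.iCycles i) (P.toCycles i j)
      (by rw [← cancel_mono (P.iCycles j)]; simp)).ShortExact where
  exact := cycles_exact P i j hij
  mono_f := by dsimp; infer_instance
  epi_g := by
    obtain rfl : i = (ComplexShape.up ℤ).prev j := by simp [← hij]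
    exact ShortComplex.Exact.epi_toCycles hj

lemma finPD_of_perfect (M : ModuleCat.{u} R)
    (h : IsPerfect R ((HomologicalComplex.single (ModuleCat.{u} R) (ComplexShape.up ℤ) 0).obj M)) :
    FinPD M := by
  obtain ⟨P, f, ⟨⟨a, b, hab⟩, -, hproj⟩, hf⟩ := h
  have hex : ∀ i, i ≠ 0 → P.ExactAt i := fun i hi =>
    (quasiIsoAt_iff_exactAt' f i
      (HomologicalComplex.exactAt_single_obj (ComplexShape.up ℤ) 0 M i hi)).1 inferInstance
  have hX : ∀ i, FinPD (P.X i) := fun i => FinPD.of_projective _ (hproj i)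
  have hz : ∀ i, (i < a ∨ b < i) → FinPD (P.cycles i) := fun i hi =>
    FinPD.of_isZero (IsZero.of_mono (P.iCycles i) (hab i hi))
  have hpos : ∀ (n : ℕ) (i : ℤ), 0 ≤ i → b < i + n → FinPD (P.cycles i) := by
    intro n
    induction n with
    | zero => intro i _ hi; exact hz i (Or.inr (by simpa using hi))
    | succ n ih =>
      intro i h0 hi
      exact FinPD.X₁ (cycles_shortExact P i (i + 1) rfl (hex _ (by omega))) (hX i)
        (ih (i + 1) (by omega) (by push_cast at hi; omega))
  have hneg : ∀ (n : ℕ) (i : ℤ), i < 0 → i - n < a → FinPD (P.cycles i) := by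
    intro n
    induction n with
    | zero => intro i _ hi; exact hz i (Or.inl (by simpa using hi))
    | succ n ih =>
      intro i h0 hi
      exact FinPD.X₃ (cycles_shortExact P (i - 1) i (by omega) (hex _ (by omega)))
        (ih (i - 1) (by omega) (by push_cast at hi; omega)) (hX (i - 1))
  have h0 : FinPD (P.cycles 0) := hpos (b + 1).toNat 0 le_rfl (by omega)
  have h1 : FinPD (P.cycles (-1)) := hneg (- a).toNat (-1) (by omega) (by omega)
  have hH : FinPD (P.homology 0) :=
    FinPD.coker
      (P.iCycles (-1)) (P.toCycles (-1) 0) (P.homologyπ 0)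
      (by rw [← cancel_mono (P.iCycles 0)]; simp) (by simp)
      (cycles_exact P (-1) 0 (by omega))
      (ShortComplex.exact_of_g_is_cokernel _ (P.homologyIsCokernel (-1) 0 (by simp)))
      h1 (hX _) h0
  exact hH.of_iso (asIso (HomologicalComplex.homologyMap f 0) ≪≫
    HomologicalComplex.singleObjHomologySelfIso (ComplexShape.up ℤ) 0 M)

lemma quasiIso_cone_desc {P : CochainComplex (ModuleCat.{u} R) ℤ}
    {S : ShortComplex (CochainComplex (ModuleCat.{u} R) ℤ)} (hS : S.ShortExact)
    (q : P ⟶ S.X₁) (hq : QuasiIso q) :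
    ∃ f : CochainComplex.mappingCone (q ≫ S.f) ⟶ S.X₃, QuasiIso f := by
  let := HasDerivedCategory.standard (ModuleCat.{u} R)
  have := CochainComplex.mappingCone.quasiIso_descShortComplex hS
  let t := CochainComplex.mappingCone.triangleMap (q ≫ S.f) S.f q (𝟙 _) (by simp)
  have ht : QuasiIso t.hom₃ := by
    rw [← DerivedCategory.isIso_Q_map_iff_quasiIso]
    refine Pretriangulated.isIso₃_of_isIso₁₂ (DerivedCategory.Q.mapTriangle.map t)
      (DerivedCategory.mappingCone_triangle_distinguished _)
      (DerivedCategory.mappingCone_triangle_distinguished _) ?_ ?_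
    · exact (DerivedCategory.isIso_Q_map_iff_quasiIso _ q).2 hq
    · exact (DerivedCategory.isIso_Q_map_iff_quasiIso _ (𝟙 S.X₂)).2 inferInstance
  let t₃ : CochainComplex.mappingCone (q ≫ S.f) ⟶ CochainComplex.mappingCone S.f := t.hom₃
  have ht₃ : QuasiIso t₃ := ht
  exact ⟨t₃ ≫ CochainComplex.mappingCone.descShortComplex S, inferInstance⟩

lemma fgproj_biprod_s3 (M N : ModuleCat.{u} R) (h1 : Module.Finite R M) (h2 : Module.Finite R N)
    (h3 : Module.Projective R M) (h4 : Module.Projective R N) :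
    Module.Finite R (M ⊞ N : ModuleCat.{u} R) ∧ Module.Projective R (M ⊞ N : ModuleCat.{u} R) := by
  let e := (ModuleCat.biprodIsoProd M N).toLinearEquiv
  exact ⟨Module.Finite.equiv e.symm, Module.Projective.of_equiv e.symm⟩

lemma fgproj_cone {P Q : CochainComplex (ModuleCat.{u} R) ℤ} (f : P ⟶ Q)
    (hP : IsBoundedFGProj R P) (hQ : IsBoundedFGProj R Q) :
    IsBoundedFGProj R (CochainComplex.mappingCone f) := by
  obtain ⟨⟨a, b, hab⟩, hP1, hP2⟩ := hP
  obtain ⟨⟨a', b', hab'⟩, hQ1, hQ2⟩ := hQ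
  have key := fun i => fgproj_biprod_s3 (P.X (i+1)) (Q.X i) (hP1 _) (hQ1 _) (hP2 _) (hQ2 _)
  have e := fun i : ℤ => (HomologicalComplex.homotopyCofiber.XIsoBiprod f i (i+1) rfl).toLinearEquiv
  refine ⟨⟨min (a - 1) a', max b b', fun i hi => ?_⟩, fun i => ?_, fun i => ?_⟩
  · rw [CochainComplex.mappingCone.isZero_X_iff]
    exact ⟨hab _ (by omega), hab' _ (by omega)⟩
  · have := (key i).1
    exact Module.Finite.equiv (e i).symm
  · have := (key i).2
    exact Module.Projective.of_equiv (e i).symm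

lemma exists_cover (M : ModuleCat.{u} R) (hM : Module.Finite R M) :
    ∃ (F : ModuleCat.{u} R) (p : F ⟶ M), Epi p ∧ Module.Finite R F ∧ Module.Projective R F ∧
      (IsZero M → IsZero F) := by
  by_cases h : IsZero M
  · have : Subsingleton M := ModuleCat.subsingleton_of_isZero h
    exact ⟨M, 𝟙 M, inferInstance, hM,
      Module.Projective.of_free (R := R) (P := M), fun h => h⟩
  · obtain ⟨n, f, hf⟩ := Module.Finite.exists_fin' R M
    exact ⟨ModuleCat.of R (Fin n → R), ModuleCat.ofHom f, (ModuleCat.epi_iff_surjective _).2 hf,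
      inferInstanceAs (Module.Finite R (Fin n → R)),
      inferInstanceAs (Module.Projective R (Fin n → R)), fun h' => (h h').elim⟩

lemma exists_complex_cover (A : CochainComplex (ModuleCat.{u} R) ℤ)
    (hbd : IsBounded R A) (hfg : ∀ i : ℤ, Module.Finite R (A.X i)) :
    ∃ (P : CochainComplex (ModuleCat.{u} R) ℤ) (p : P ⟶ A), IsBoundedFGProj R P ∧ Epi p := by
  choose F p hp hF1 hF2 hF3 using fun i => exists_cover (A.X i) (hfg i)
  obtain ⟨a, b, hab⟩ := hbd
  let X : ℤ → ModuleCat.{u} R := fun i => F i ⊞ F (i - 1)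
  let d : ∀ i, X i ⟶ X (i + 1) := fun i =>
    biprod.fst ≫ eqToHom (by congr 1; omega) ≫ biprod.inr
  have hd : ∀ i, d i ≫ d (i + 1) = 0 := fun i => by simp [d]
  let φ : ∀ i, X i ⟶ A.X i := fun i => biprod.desc (p i) (p (i - 1) ≫ A.d (i - 1) i)
  have haux : ∀ (i j k : ℤ) (h : i = j), eqToHom (congrArg F h) ≫ p j ≫ A.d j k = p i ≫ A.d i k := by
    rintro i _ k rfl; simp
  have hφ : ∀ i, φ i ≫ A.d i (i + 1) = d i ≫ φ (i + 1) := by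
    intro i
    dsimp only [d, φ, X]
    rw [Category.assoc, Category.assoc, biprod.inr_desc, haux]
    · apply biprod.hom_ext' <;> simp
    · omega
  refine ⟨CochainComplex.of X d hd, CochainComplex.ofHom φ (fun i => by simpa using hφ i), ⟨⟨a, b + 1, ?_⟩, ?_, ?_⟩, ?_⟩
  · intro i hi
    exact (biprod_isZero_iff (F i) (F (i - 1))).2
      ⟨hF3 _ (hab _ (by omega)), hF3 _ (hab _ (by omega))⟩
  · exact fun i => (fgproj_biprod_s3 _ _ (hF1 _) (hF1 _) (hF2 _) (hF2 _)).1
  · exact fun i => (fgproj_biprod_s3 _ _ (hF1 _) (hF1 _) (hF2 _) (hF2 _)).2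
  · refine HomologicalComplex.epi_of_epi_f _ (fun i => ?_)
    have : Epi (biprod.inl ≫ φ i) := by
      dsimp only [φ]
      rw [biprod.inl_desc]
      exact hp i
    exact epi_of_epi biprod.inl (φ i)

lemma perfect_of_pd [IsNoetherianRing R] (n : ℕ) :
    ∀ (A : CochainComplex (ModuleCat.{u} R) ℤ) (_ : IsBounded R A)
      (_ : ∀ i : ℤ, Module.Finite R (A.X i))
      (_ : ∀ i : ℤ, HasProjectiveDimensionLT (A.X i) (n + 1)), IsPerfect R A := by
  induction n with
  | zero =>
    intro A hbd hfg hpd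
    refine ⟨A, 𝟙 A, ⟨hbd, hfg, fun i => ?_⟩, inferInstance⟩
    have := hpd i
    exact (IsProjective.iff_projective.{u} (R := R) (A.X i)).2
      (projective_iff_hasProjectiveDimensionLT_one.2 this)
  | succ n ih =>
    intro A hbd hfg hpd
    obtain ⟨P, p, hP, hp⟩ := exists_complex_cover A hbd hfg
    let S := ShortComplex.mk (kernel.ι p) p (kernel.condition p)
    have hS : S.ShortExact :=
      { exact := ShortComplex.exact_kernel p
        mono_f := by dsimp [S]; infer_instance
        epi_g := hp }
    have hSi := (HomologicalComplex.shortExact_iff_degreewise_shortExact S).1 hS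
    have hmono : ∀ i, Mono (S.f.f i) := fun i => (hSi i).mono_f
    obtain ⟨Q, q, hQ, hq⟩ := ih S.X₁ (by
        obtain ⟨⟨a, b, hab⟩, -, -⟩ := hP
        exact ⟨a, b, fun i hi => IsZero.of_mono (S.f.f i) (hab i hi)⟩)
      (fun i => by
        have : Module.Finite R (S.X₂.X i) := hP.2.1 i
        exact Module.Finite.of_injective (S.f.f i).hom
          ((ModuleCat.mono_iff_injective _).1 (hmono i)))
      (fun i => by
        have h1 : Projective (S.X₂.X i) :=
          (IsProjective.iff_projective.{u} (R := R) (S.X₂.X i)).1 (hP.2.2 i)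
        exact ((hSi i).hasProjectiveDimensionLT_X₃_iff n h1).1 (hpd i))
    obtain ⟨f, hf⟩ := quasiIso_cone_desc hS q hq
    exact ⟨_, f, fgproj_cone _ hQ hP, hf⟩

end PerfectHelpers


/-- If `R` is a regular ring (noetherian, and every finitely generated `R`-module admits a
finite resolution by finitely generated projective `R`-modules, i.e. `M[0]` is perfect),
then every bounded cochain complex of finitely generated `R`-modules is perfect. -/
theorem statement3 {R : Type u} [Ring R] [IsNoetherianRing R]
    (hreg : ∀ M : ModuleCat.{u} R, Module.Finite R M →
      IsPerfect R ((HomologicalComplex.single (ModuleCat.{u} R) (ComplexShape.up ℤ) 0).obj M))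
    (A : CochainComplex (ModuleCat.{u} R) ℤ)
    (hbd : IsBounded R A) (hfg : ∀ i : ℤ, Module.Finite R (A.X i)) :
    IsPerfect R A := by
  obtain ⟨a, b, hab⟩ := hbd
  choose n hn using fun i => finPD_of_perfect (A.X i) (hreg (A.X i) (hfg i))
  refine perfect_of_pd ((Finset.Icc a b).sup n) A ⟨a, b, hab⟩ hfg (fun i => ?_)
  by_cases hi : i ∈ Finset.Icc a b
  · have := hn i
    exact hasProjectiveDimensionLT_of_ge _ (n i) _
      ((Finset.le_sup (f := n) hi).trans (Nat.le_succ _))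
  · have := (hab i (by simp only [Finset.mem_Icc] at hi; omega)).hasProjectiveDimensionLT_zero
    exact hasProjectiveDimensionLT_of_ge _ 0 _ (Nat.zero_le _)
end

section
/- Let R be a ring and let a : A ⟶ B be a morphism of bounded cochain complexes of projective R-modules. Then the mapping cone of a is acyclic (has vanishing cohomology in all degrees) if and only if a is a homotopy equivalence, i.e. there exists a morphism b : B ⟶ A such that b ∘ a and a ∘ b are chain homotopic to the respective identities. Equivalently, a quasi-isomorphism between bounded cochain complexes of projective R-modules is a homotopy equivalence. -/
open CategoryTheory Limits

universe u

variable (R : Type u) [Ring R]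

section
open CategoryTheory Limits

lemma isKProj_aux {R : Type u} [Ring R] (A : CochainComplex (ModuleCat.{u} R) ℤ)
    (hA : IsBounded R A) (hp : ∀ i : ℤ, Module.Projective R (A.X i)) : A.IsKProjective := by
  obtain ⟨_, b, h⟩ := hA
  have : A.IsStrictlyLE b := by
    rw [CochainComplex.isStrictlyLE_iff]
    intro i hi
    exact h i (Or.inr hi)
  have (n : ℤ) : Projective (A.X n) := (IsProjective.iff_projective (A.X n)).1 (hp n)
  exact CochainComplex.isKProjective_of_projective A b

lemma cone_aux {R : Type u} [Ring R] {A B : CochainComplex (ModuleCat.{u} R) ℤ} (a : A ⟶ B) :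
    (∀ i : ℤ, Limits.IsZero ((CochainComplex.mappingCone a).homology i)) ↔ QuasiIso a := by
  rw [← HomologicalComplex.mem_quasiIso_iff, ← HomotopyCategory.quotient_map_mem_quasiIso_iff,
    HomotopyCategory.quasiIso_eq_trW_subcategoryAcyclic]
  refine Iff.trans ?_ ((HomotopyCategory.subcategoryAcyclic _).trW_iff_of_distinguished _
      (HomotopyCategory.mappingCone_triangleh_distinguished a)).symm
  simp only [← HomologicalComplex.exactAt_iff_isZero_homology]
  exact (HomotopyCategory.quotient_obj_mem_subcategoryAcyclic_iff_exactAt _).symm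

end

/-- For a morphism `a : A ⟶ B` of bounded cochain complexes of projective `R`-modules,
the mapping cone of `a` is acyclic iff `a` is a homotopy equivalence; equivalently, `a` is
a quasi-isomorphism iff it is a homotopy equivalence. -/
theorem statement6 {R : Type u} [Ring R]
    (A B : CochainComplex (ModuleCat.{u} R) ℤ)
    (hAbd : IsBounded R A) (hBbd : IsBounded R B)
    (hAproj : ∀ i : ℤ, Module.Projective R (A.X i))
    (hBproj : ∀ i : ℤ, Module.Projective R (B.X i))
    (a : A ⟶ B) :
    ((∀ i : ℤ, Limits.IsZero ((CochainComplex.mappingCone a).homology i)) ↔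
      ∃ b : B ⟶ A, Nonempty (Homotopy (a ≫ b) (𝟙 A)) ∧ Nonempty (Homotopy (b ≫ a) (𝟙 B))) ∧
    (QuasiIso a ↔
      ∃ b : B ⟶ A, Nonempty (Homotopy (a ≫ b) (𝟙 A)) ∧ Nonempty (Homotopy (b ≫ a) (𝟙 B))) := by
  have := isKProj_aux A hAbd hAproj
  have := isKProj_aux B hBbd hBproj
  have key : QuasiIso a ↔
      ∃ b : B ⟶ A, Nonempty (Homotopy (a ≫ b) (𝟙 A)) ∧ Nonempty (Homotopy (b ≫ a) (𝟙 B)) := by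
    rw [CochainComplex.IsKProjective.quasiIso_iff]
    constructor
    · rintro ⟨e, rfl⟩
      exact ⟨e.inv, ⟨e.homotopyHomInvId⟩, ⟨e.homotopyInvHomId⟩⟩
    · rintro ⟨b, ⟨h₁⟩, ⟨h₂⟩⟩
      exact ⟨⟨a, b, h₁, h₂⟩, rfl⟩
  exact ⟨(cone_aux a).trans key, key⟩
end

section
/- Let R be a ring and let a : A ⟶ B be a morphism of cochain complexes of R-modules with A and B perfect. Then the mapping cone of a is a perfect complex of R-modules. (Thus the full subcategory of perfect complexes is closed under mapping cones, so the perfect complexes form a triangulated subcategory of the derived category of R-modules.) -/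
open CategoryTheory Limits

universe u

variable (R : Type u) [Ring R]

theorem mappingCone_boundedFGProj {R : Type u} [Ring R]
    {P Q : CochainComplex (ModuleCat.{u} R) ℤ} (b : P ⟶ Q)
    (hP : IsBoundedFGProj R P) (hQ : IsBoundedFGProj R Q) :
    IsBoundedFGProj R (CochainComplex.mappingCone b) := by
  obtain ⟨⟨a₁, b₁, h₁⟩, fP, pP⟩ := hP
  obtain ⟨⟨a₂, b₂, h₂⟩, fQ, pQ⟩ := hQ
  have e : ∀ i : ℤ, Nonempty ((CochainComplex.mappingCone b).X i ≃ₗ[R] (P.X (i + 1) × Q.X i)) :=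
    fun i => ⟨((HomologicalComplex.homotopyCofiber.XIsoBiprod b i (i + 1) rfl) ≪≫
      ModuleCat.biprodIsoProd _ _).toLinearEquiv⟩
  refine ⟨⟨min (a₁ - 1) a₂, max b₁ b₂, fun i hi => ?_⟩, fun i => ?_, fun i => ?_⟩
  · rw [CochainComplex.mappingCone.isZero_X_iff]
    exact ⟨h₁ _ (by omega), h₂ _ (by omega)⟩
  · obtain ⟨e⟩ := e i
    have := fP (i + 1)
    have := fQ i
    exact Module.Finite.equiv e.symm
  · obtain ⟨e⟩ := e i
    have := pP (i + 1)
    have := pQ i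
    exact Module.Projective.of_equiv e.symm

theorem isKProjective_of_boundedFGProj {R : Type u} [Ring R]
    {P : CochainComplex (ModuleCat.{u} R) ℤ} (hP : IsBoundedFGProj R P) :
    P.IsKProjective := by
  obtain ⟨⟨a, b, h⟩, -, pP⟩ := hP
  have : P.IsStrictlyLE b := by
    rw [CochainComplex.isStrictlyLE_iff]
    intro i hi
    exact h i (Or.inr hi)
  have : ∀ n, Projective (P.X n) := fun n =>
    (IsProjective.iff_projective (R := R) (P.X n)).1 (pP n)
  exact CochainComplex.isKProjective_of_projective P b

open DerivedCategory in
theorem exists_lift_of_isKProjective {C : Type*} [Category* C] [Abelian C]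
    {P Q B : CochainComplex C ℤ} [P.IsKProjective] (c : P ⟶ B) (g : Q ⟶ B) [QuasiIso g] :
    ∃ b : P ⟶ Q, Nonempty (Homotopy (b ≫ g) c) := by
  let := HasDerivedCategory.standard C
  let q := HomotopyCategory.quotient C (ComplexShape.up ℤ)
  have : IsIso (Qh.map (q.map g)) :=
    (NatIso.isIso_map_iff (quotientCompQhIso C) g).2 inferInstance
  obtain ⟨b', hb'⟩ := (CochainComplex.IsKProjective.Qh_map_bijective P (q.obj Q)).surjective
    (Qh.map (q.map c) ≫ inv (Qh.map (q.map g)))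
  obtain ⟨b, rfl⟩ := q.map_surjective b'
  refine ⟨b, ⟨HomotopyCategory.homotopyOfEq _ _ ?_⟩⟩
  apply (CochainComplex.IsKProjective.Qh_map_bijective P (q.obj B)).injective
  change Qh.map (q.map (b ≫ g)) = Qh.map (q.map c)
  rw [q.map_comp, Qh.map_comp, hb', Category.assoc, IsIso.inv_hom_id, Category.comp_id]

open DerivedCategory CochainComplex.mappingCone in
theorem quasiIso_mapOfHomotopy {C : Type*} [Category* C] [Abelian C]
    {K₁ L₁ K₂ L₂ : CochainComplex C ℤ} {φ₁ : K₁ ⟶ L₁} {φ₂ : K₂ ⟶ L₂}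
    {a : K₁ ⟶ K₂} {b : L₁ ⟶ L₂} (H : Homotopy (φ₁ ≫ b) (a ≫ φ₂))
    [QuasiIso a] [QuasiIso b] : QuasiIso (mapOfHomotopy H) := by
  let := HasDerivedCategory.standard C
  have key : ∀ {K L : CochainComplex C ℤ} (g : K ⟶ L),
      IsIso (Qh.map ((HomotopyCategory.quotient C (ComplexShape.up ℤ)).map g)) ↔ QuasiIso g :=
    fun g => (NatIso.isIso_map_iff (quotientCompQhIso C) g).trans (isIso_Q_map_iff_quasiIso _ g)
  rw [← key]
  exact Pretriangulated.isIso₃_of_isIso₁₂ (Qh.mapTriangle.map (trianglehMapOfHomotopy H))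
    (Qh.map_distinguished _ (HomotopyCategory.mappingCone_triangleh_distinguished φ₁))
    (Qh.map_distinguished _ (HomotopyCategory.mappingCone_triangleh_distinguished φ₂))
    ((key a).2 inferInstance) ((key b).2 inferInstance)

/-- The mapping cone of a morphism between perfect cochain complexes of `R`-modules is
perfect. -/
theorem statement8 {R : Type u} [Ring R]
    (A B : CochainComplex (ModuleCat.{u} R) ℤ) (a : A ⟶ B)
    (hA : IsPerfect R A) (hB : IsPerfect R B) :
    IsPerfect R (CochainComplex.mappingCone a) := by
  obtain ⟨P, f, hP, hf⟩ := hA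
  obtain ⟨Q, g, hQ, hg⟩ := hB
  have := isKProjective_of_boundedFGProj hP
  obtain ⟨b, ⟨H⟩⟩ := exists_lift_of_isKProjective (f ≫ a) g
  exact ⟨_, CochainComplex.mappingCone.mapOfHomotopy H, mappingCone_boundedFGProj b hP hQ,
    quasiIso_mapOfHomotopy H⟩
end

section
/- Let R be a ring and let 0 → A → B → C → 0 be a short exact sequence of cochain complexes of R-modules (exact in each degree). If two of the three complexes A, B, C are perfect, then so is the third. (In particular, the category of perfect complexes of R-modules is a full subcategory of the category of all cochain complexes of R-modules that is closed under extensions, and hence is an exact category.) -/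
open CategoryTheory Limits

universe u

variable (R : Type u) [Ring R]

namespace PerfectAux

open CategoryTheory Limits Pretriangulated DerivedCategory

attribute [local instance] HasDerivedCategory.standard

variable {R : Type u} [Ring R]

lemma isKProjective {P : CochainComplex (ModuleCat.{u} R) ℤ} (hP : IsBoundedFGProj R P) :
    P.IsKProjective := by
  obtain ⟨⟨a, b, hab⟩, -, hp⟩ := hP
  have : P.IsStrictlyLE b := by
    rw [CochainComplex.isStrictlyLE_iff]
    intro i hi
    exact hab i (Or.inr hi)
  have (n : ℤ) : Projective (P.X n) := by
    rw [← IsProjective.iff_projective]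
    exact hp n
  exact CochainComplex.isKProjective_of_projective P b

/-- Morphisms out of `P` in the derived category lift to morphisms of complexes. -/
lemma exists_lift {P : CochainComplex (ModuleCat.{u} R) ℤ} (hP : IsBoundedFGProj R P)
    (A : CochainComplex (ModuleCat.{u} R) ℤ) (e : Q.obj P ⟶ Q.obj A) :
    ∃ f : P ⟶ A, Q.map f = e := by
  have := isKProjective hP
  obtain ⟨g, hg⟩ := (CochainComplex.IsKProjective.Qh_map_bijective P
    ((HomotopyCategory.quotient _ _).obj A)).surjective
    ((quotientCompQhIso _).hom.app P ≫ e ≫ (quotientCompQhIso _).inv.app A)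
  obtain ⟨f, rfl⟩ := (HomotopyCategory.quotient _ _).map_surjective g
  refine ⟨f, ?_⟩
  have h := quotientCompQhIso_hom_naturality f
  rw [hg] at h
  rw [← cancel_epi ((quotientCompQhIso _).hom.app P), ← h]
  simp

/-- Perfect objects of the derived category. -/
def Perf (X : DerivedCategory (ModuleCat.{u} R)) : Prop :=
  ∃ P : CochainComplex (ModuleCat.{u} R) ℤ, IsBoundedFGProj R P ∧ Nonempty (Q.obj P ≅ X)

lemma Perf.of_iso {X Y : DerivedCategory (ModuleCat.{u} R)} (h : Perf X) (e : X ≅ Y) : Perf Y := by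
  obtain ⟨P, hP, ⟨i⟩⟩ := h
  exact ⟨P, hP, ⟨i ≪≫ e⟩⟩

lemma isPerfect_iff (A : CochainComplex (ModuleCat.{u} R) ℤ) :
    IsPerfect R A ↔ Perf (Q.obj A) := by
  constructor
  · rintro ⟨P, f, hP, hf⟩
    exact ⟨P, hP, ⟨asIso (Q.map f)⟩⟩
  · rintro ⟨P, hP, ⟨e⟩⟩
    obtain ⟨f, hf⟩ := exists_lift hP A e.hom
    refine ⟨P, f, hP, ?_⟩
    rw [← isIso_Q_map_iff_quasiIso, hf]
    infer_instance

lemma Perf.shift {X : DerivedCategory (ModuleCat.{u} R)} (h : Perf X) (n : ℤ) :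
    Perf (X⟦n⟧) := by
  obtain ⟨P, ⟨⟨a, b, hab⟩, hf, hp⟩, ⟨e⟩⟩ := h
  refine ⟨P⟦n⟧, ⟨⟨a - n, b - n, fun i hi ↦ hab (i + n) (by lia)⟩,
    fun i ↦ hf (i + n), fun i ↦ hp (i + n)⟩,
    ⟨(Q.commShiftIso n).app P ≪≫ (shiftFunctor _ n).mapIso e⟩⟩

lemma cone_isBoundedFGProj {P P' : CochainComplex (ModuleCat.{u} R) ℤ}
    (hP : IsBoundedFGProj R P) (hP' : IsBoundedFGProj R P') (φ : P ⟶ P') :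
    IsBoundedFGProj R (CochainComplex.mappingCone φ) := by
  obtain ⟨⟨a, b, hab⟩, hf, hp⟩ := hP
  obtain ⟨⟨a', b', hab'⟩, hf', hp'⟩ := hP'
  have e (i : ℤ) : (CochainComplex.mappingCone φ).X i ≃ₗ[R] (P.X (i + 1) × P'.X i) :=
    ((HomologicalComplex.homotopyCofiber.XIsoBiprod φ i (i + 1) rfl) ≪≫
      ModuleCat.biprodIsoProd _ _).toLinearEquiv
  refine ⟨⟨min (a - 1) a', max b b', fun i hi ↦ ?_⟩, fun i ↦ ?_, fun i ↦ ?_⟩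
  · rw [CochainComplex.mappingCone.isZero_X_iff]
    exact ⟨hab _ (by lia), hab' _ (by lia)⟩
  · have := hf (i + 1)
    have := hf' i
    exact Module.Finite.equiv (e i).symm
  · have := hp (i + 1)
    have := hp' i
    exact Module.Projective.of_equiv (e i).symm

lemma perf₃ (T : Triangle (DerivedCategory (ModuleCat.{u} R))) (hT : T ∈ distTriang _)
    (h₁ : Perf T.obj₁) (h₂ : Perf T.obj₂) : Perf T.obj₃ := by
  obtain ⟨P, hP, ⟨e₁⟩⟩ := h₁
  obtain ⟨P', hP', ⟨e₂⟩⟩ := h₂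
  obtain ⟨φ, hφ⟩ := exists_lift hP P' (e₁.hom ≫ T.mor₁ ≫ e₂.inv)
  have hT' := mappingCone_triangle_distinguished φ
  refine ⟨_, cone_isBoundedFGProj hP hP' φ,
    ⟨Triangle.π₃.mapIso (isoTriangleOfIso₁₂ _ _ hT' hT e₁ e₂ ?_)⟩⟩
  change Q.map φ ≫ e₂.hom = e₁.hom ≫ T.mor₁
  simp [hφ]

lemma perf₁ (T : Triangle (DerivedCategory (ModuleCat.{u} R))) (hT : T ∈ distTriang _)
    (h₂ : Perf T.obj₂) (h₃ : Perf T.obj₃) : Perf T.obj₁ :=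
  ((perf₃ T.rotate (rot_of_distTriang _ hT) h₂ h₃).shift (-1)).of_iso
    ((shiftEquiv (DerivedCategory (ModuleCat.{u} R)) (1 : ℤ)).unitIso.symm.app T.obj₁)

lemma perf₂ (T : Triangle (DerivedCategory (ModuleCat.{u} R))) (hT : T ∈ distTriang _)
    (h₁ : Perf T.obj₁) (h₃ : Perf T.obj₃) : Perf T.obj₂ :=
  perf₃ T.invRotate (inv_rot_of_distTriang _ hT) (h₃.shift (-1)) h₁

lemma shortExact {A B C : CochainComplex (ModuleCat.{u} R) ℤ} (f : A ⟶ B) (g : B ⟶ C)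
    (h : IsShortExactSeq R f g) :
    ∃ w : f ≫ g = 0, (ShortComplex.mk f g w).ShortExact := by
  have w : f ≫ g = 0 := by
    ext i x
    exact (h i).2.1.apply_apply_eq_zero x
  refine ⟨w, HomologicalComplex.shortExact_of_degreewise_shortExact _ fun i ↦ ?_⟩
  obtain ⟨h₁, h₂, h₃⟩ := h i
  exact
    { exact := (ShortComplex.ShortExact.moduleCat_exact_iff_function_exact _).2 h₂
      mono_f := (ModuleCat.mono_iff_injective _).2 h₁
      epi_g := (ModuleCat.epi_iff_surjective _).2 h₃ }

end PerfectAux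

/-- In a degreewise short exact sequence `0 → A → B → C → 0` of cochain complexes of
`R`-modules, if two of the three complexes are perfect then so is the third. -/
theorem statement9 {R : Type u} [Ring R]
    (A B C : CochainComplex (ModuleCat.{u} R) ℤ)
    (f : A ⟶ B) (g : B ⟶ C) (hses : IsShortExactSeq R f g) :
    (IsPerfect R A → IsPerfect R B → IsPerfect R C) ∧
    (IsPerfect R A → IsPerfect R C → IsPerfect R B) ∧
    (IsPerfect R B → IsPerfect R C → IsPerfect R A) := by
  obtain ⟨w, hS⟩ := PerfectAux.shortExact f g hses
  let := HasDerivedCategory.standard (ModuleCat.{u} R)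
  have hT := DerivedCategory.triangleOfSES_distinguished hS
  simp only [PerfectAux.isPerfect_iff]
  exact ⟨PerfectAux.perf₃ _ hT, PerfectAux.perf₂ _ hT, PerfectAux.perf₁ _ hT⟩
end
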